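/- Let a ≥ 1 be an odd integer and b ≥ 2 an even integer, and set N = a + b. Then ζ(a,b) = − Σ_{r=3, r odd}^{N−2} ( C(r−1, b−1) + C(r−1, a−1) ) · ζ(r) · ζ(N−r) + (1/2)·( C(N, b) − 1 )·ζ(N) + [a ≥ 3]·ζ(a)·ζ(b), where the sum is over odd integers r with 3 ≤ r ≤ N−2, C(m, l) denotes the binomial coefficient, and [a ≥ 3] equals 1 if a ≥ 3 and 0 if a = 1. -/

import Mathlib

/-- The single zeta value `ζ(n) = ∑_{k ≥ 1} 1 / k^n`. -/
noncomputable def zetaValue (n : ℕ) : ℝ := ∑' k : ℕ+, (1 : ℝ) / ((k : ℕ) : ℝ) ^ n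

/-- The double zeta value `ζ(a,b) = ∑_{l > k ≥ 1} 1 / (k^a * l^b)`. -/
noncomputable def doubleZeta (a b : ℕ) : ℝ :=
  ∑' p : {p : ℕ+ × ℕ+ // p.1 < p.2},
    (1 : ℝ) / (((p.1.1 : ℕ) : ℝ) ^ a * ((p.1.2 : ℕ) : ℝ) ^ b)

open Finset
noncomputable def TT (s y : ℝ) (a b : ℕ) : ℝ :=
  ∑ j ∈ Finset.range (a + b + 1), (Nat.choose j a : ℝ) * (s ^ (j + 1) * y ^ (a + b + 1 - j))

theorem TT_succ_succ (s y : ℝ) (a b : ℕ) :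
    TT s y (a + 1) (b + 1) = s * (TT s y a (b + 1) + TT s y (a + 1) b) := by
  unfold TT
  rw [show a + 1 + (b + 1) + 1 = (a + (b + 1) + 1) + 1 by ring, Finset.sum_range_succ',
    show a + 1 + b + 1 = a + (b + 1) + 1 by ring, ← Finset.sum_add_distrib, Finset.mul_sum]
  simp only [Nat.choose_zero_succ, Nat.cast_zero, zero_mul, add_zero]
  refine Finset.sum_congr rfl fun j _ => ?_
  rw [Nat.choose_succ_succ, Nat.add_sub_add_right]
  push_cast
  ring

theorem TT_zero_succ (s y : ℝ) (b : ℕ) :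
    TT s y 0 (b + 1) = s * (y ^ (b + 2) + TT s y 0 b) := by
  unfold TT
  rw [show 0 + (b + 1) + 1 = (0 + b + 1) + 1 by ring, Finset.sum_range_succ', mul_add,
    Finset.mul_sum, add_comm]
  congr 1
  · simp
  refine Finset.sum_congr rfl fun j _ => ?_
  rw [Nat.add_sub_add_right]
  simp
  ring

theorem TT_succ_zero (s y : ℝ) (a : ℕ) :
    TT s y (a + 1) 0 = s * TT s y a 0 := by
  unfold TT
  rw [show a + 1 + 0 + 1 = (a + 0 + 1) + 1 by ring, Finset.sum_range_succ', Finset.mul_sum]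
  simp only [Nat.choose_zero_succ, Nat.cast_zero, zero_mul, add_zero]
  rw [Finset.sum_range_succ, Finset.sum_range_succ]
  have h : ∀ (c : ℕ → ℝ), ∑ j ∈ range a, (Nat.choose j a : ℝ) * c j = 0 := fun c =>
    Finset.sum_eq_zero fun j hj => by rw [Nat.choose_eq_zero_of_lt (Finset.mem_range.1 hj)]; simp
  have h' : ∀ (c : ℕ → ℝ), ∑ j ∈ range a, (Nat.choose (j+1) (a+1) : ℝ) * c j = 0 := fun c =>
    Finset.sum_eq_zero fun j hj => by
      rw [Nat.choose_eq_zero_of_lt (by have := Finset.mem_range.1 hj; omega)]; simp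
  rw [h', Finset.sum_eq_zero]
  · simp
    ring
  · intro j hj
    rw [Nat.choose_eq_zero_of_lt (Finset.mem_range.1 hj)]; simp

theorem TT_pf (s x y : ℝ) (h : x * y = s * (x + y)) (a b : ℕ) :
    TT s y a b + TT s x b a = x ^ (a + 1) * y ^ (b + 1) := by
  induction a generalizing b with
  | zero =>
    induction b with
    | zero => simp [TT]; linear_combination -h
    | succ b ih =>
      rw [TT_zero_succ, TT_succ_zero]
      linear_combination s * ih - y ^ (b + 1) * h
  | succ a iha =>
    induction b with
    | zero =>
      rw [TT_zero_succ, TT_succ_zero]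
      linear_combination s * iha 0 - x ^ (a + 1) * h
    | succ b ih =>
      rw [TT_succ_succ, TT_succ_succ]
      linear_combination s * iha (b+1) + s * ih - x ^ (a + 1) * y ^ (b + 1) * h

theorem sum_choose (n k : ℕ) : ∑ j ∈ range n, (Nat.choose j k) = Nat.choose n (k + 1) := by
  induction n with
  | zero => simp
  | succ n ih => rw [Finset.sum_range_succ, ih, Nat.choose_succ_succ, add_comm]

theorem TT_diag (s : ℝ) (a b : ℕ) :
    TT s s a b = (Nat.choose (a + b + 1) (a + 1) : ℝ) * s ^ (a + b + 2) := by
  unfold TT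
  rw [← sum_choose, Nat.cast_sum, Finset.sum_mul]
  refine Finset.sum_congr rfl fun j hj => ?_
  rw [← pow_add]
  congr 2
  have := Finset.mem_range.1 hj
  omega

theorem TT_zero (s : ℝ) (a b : ℕ) : TT s 0 a b = 0 := by
  unfold TT
  refine Finset.sum_eq_zero fun j hj => ?_
  have := Finset.mem_range.1 hj
  rw [zero_pow (by omega)]; simp

/-- partial fractions on integers -/
theorem pf_int (l : ℕ+) (j : ℤ) (a b : ℕ) :
    (((l : ℕ) : ℝ) - (j : ℝ))⁻¹ ^ (a + 1) * (j : ℝ)⁻¹ ^ (b + 1) =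
    TT ((l : ℕ) : ℝ)⁻¹ (j : ℝ)⁻¹ a b + TT ((l : ℕ) : ℝ)⁻¹ (((l : ℕ) : ℝ) - (j : ℝ))⁻¹ b a
    - (if j = 0 then (Nat.choose (a + b + 1) (b + 1) : ℝ) * ((l : ℕ) : ℝ)⁻¹ ^ (a + b + 2) else 0)
    - (if j = ((l : ℕ) : ℤ) then (Nat.choose (a + b + 1) (a + 1) : ℝ) * ((l : ℕ) : ℝ)⁻¹ ^ (a + b + 2) else 0) := by
  have hl : ((l : ℕ) : ℝ) ≠ 0 := by exact_mod_cast l.ne_zero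
  have hl' : ((l : ℕ) : ℤ) ≠ 0 := by exact_mod_cast l.ne_zero
  by_cases h0 : j = 0
  · subst h0
    rw [if_pos rfl, if_neg hl'.symm]
    simp [TT_zero, TT_diag, add_comm]
  by_cases h1 : j = ((l : ℕ) : ℤ)
  · subst h1
    rw [if_neg hl', if_pos rfl]
    simp [TT_zero, TT_diag, add_comm]
  rw [if_neg h0, if_neg h1, sub_zero, sub_zero, TT_pf]
  have hj : (j : ℝ) ≠ 0 := by exact_mod_cast h0
  have hlj : ((l : ℕ) : ℝ) - (j : ℝ) ≠ 0 := by
    rw [sub_ne_zero]; intro h; apply h1; exact_mod_cast h.symm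
  field_simp
  ring

theorem hasSum_of_eq {ι : Type*} {f g : ι → ℝ} {x y : ℝ} (h : HasSum f x) (h1 : ∀ j, g j = f j)
    (h2 : y = x) : HasSum g y := by
  rw [h2, funext h1]; exact h

theorem hasSum_tele1 : HasSum (fun j : ℤ => (j : ℝ)⁻¹ - ((j : ℝ) - 1)⁻¹) 0 := by
  have ht : Filter.Tendsto (fun n : ℕ => ((n : ℝ) + 1)⁻¹) Filter.atTop (nhds 0) := by
    simpa using tendsto_one_div_add_atTop_nhds_zero_nat (𝕜 := ℝ)
  have key : HasSum (fun n : ℕ => ((n : ℝ) + 2)⁻¹ - ((n : ℝ) + 1)⁻¹) (-1) := by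
    have : HasSum (fun n : ℕ => ((n : ℝ) + 1)⁻¹ - ((n : ℝ) + 2)⁻¹) 1 := by
      rw [hasSum_iff_tendsto_nat_of_nonneg]
      · have : ∀ n : ℕ, ∑ i ∈ range n, (((i : ℝ) + 1)⁻¹ - ((i : ℝ) + 2)⁻¹) = 1 - ((n : ℝ) + 1)⁻¹ := by
          intro n
          induction n with
          | zero => simp
          | succ n ih => rw [Finset.sum_range_succ, ih]; push_cast; ring
        simp_rw [this]
        simpa using ht.const_sub 1
      · intro i
        rw [sub_nonneg]
        gcongr
        norm_num
    simpa using this.neg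
  have := HasSum.of_nat_of_neg_add_one (f := fun j : ℤ => (j : ℝ)⁻¹ - ((j : ℝ) - 1)⁻¹) (m := 1) (m' := -1) ?_ ?_
  · simpa using this
  · have h2 := (hasSum_nat_add_iff (f := fun n : ℕ => (((n : ℤ) : ℝ)⁻¹ - (((n : ℤ) : ℝ) - 1)⁻¹)) (g := -1) 2).1 ?_
    · refine hasSum_of_eq h2 (fun _ => rfl) ?_
      norm_num [Finset.sum_range_succ]
    · refine hasSum_of_eq key (fun n => ?_) rfl
      push_cast
      rw [show (n : ℝ) + 2 - 1 = n + 1 by ring]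
  · refine hasSum_of_eq key (fun n => ?_) rfl
    push_cast
    rw [show -((n : ℝ) + 1) - 1 = -(n + 2) by ring, inv_neg, inv_neg]
    ring

theorem hasSum_tele (l : ℕ) : HasSum (fun j : ℤ => (j : ℝ)⁻¹ + ((l : ℝ) - (j : ℝ))⁻¹) 0 := by
  induction l with
  | zero => simp [neg_inv.symm]
  | succ l ih =>
    have h := (Equiv.subRight (l : ℤ)).hasSum_iff.2 hasSum_tele1
    have := ih.add h
    rw [add_zero] at this
    convert this using 2 with j
    simp only [Function.comp, Equiv.subRight_apply]
    push_cast
    rw [show (l : ℝ) - j = -(j - l) by ring, show (l : ℝ) + 1 - j = -(j - l - 1) by ring, inv_neg, inv_neg]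
    ring


theorem hasSum_zeta (n : ℕ) (hn : 2 ≤ n) :
    HasSum (fun k : ℕ+ => ((k : ℕ) : ℝ)⁻¹ ^ n) (zetaValue n) := by
  have : Summable (fun k : ℕ+ => (1 : ℝ) / ((k : ℕ) : ℝ) ^ n) :=
    (Real.summable_one_div_nat_pow.2 (by omega)).comp_injective PNat.coe_injective
  simpa [zetaValue] using this.hasSum

noncomputable def Zv (i : ℕ) : ℝ := if Even i then 2 * zetaValue i else 0

/-- sum over ℤ from sums over ℕ+ -/
theorem hasSum_int_of_pnat {f : ℤ → ℝ} {x y : ℝ} (h0 : f 0 = 0)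
    (hx : HasSum (fun k : ℕ+ => f ((k : ℕ) : ℤ)) x) (hy : HasSum (fun k : ℕ+ => f (-((k : ℕ) : ℤ))) y) :
    HasSum f (x + y) := by
  apply HasSum.of_nat_of_neg_add_one
  · have := (PNat.coe_injective.hasSum_iff (f := fun n : ℕ => f (n : ℤ)) (a := x) ?_).1 hx
    · exact this
    · intro n hn
      have : n = 0 := by
        by_contra h
        exact hn ⟨⟨n, Nat.pos_of_ne_zero h⟩, rfl⟩
      subst this
      simpa using h0
  · have := (Equiv.pnatEquivNat.symm.hasSum_iff).2 hy
    convert this using 2 with n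
    simp [Function.comp]

theorem hasSum_Zv (i : ℕ) (hi : 2 ≤ i) : HasSum (fun j : ℤ => (j : ℝ)⁻¹ ^ i) (Zv i) := by
  have h := hasSum_zeta i hi
  by_cases he : Even i
  · rw [Zv, if_pos he, two_mul]
    apply hasSum_int_of_pnat
    · simp; omega
    · simpa using h
    · simpa [he.neg_pow] using h
  · rw [Zv, if_neg he, ← add_neg_cancel (zetaValue i)]
    apply hasSum_int_of_pnat
    · simp; omega
    · simpa using h
    · simpa [inv_neg, (Nat.not_even_iff_odd.1 he).neg_pow] using h.neg

theorem hasSum_row_F (l : ℕ+) (a b : ℕ) :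
    HasSum (fun j : ℤ => TT ((l : ℕ) : ℝ)⁻¹ (j : ℝ)⁻¹ a b
      + TT ((l : ℕ) : ℝ)⁻¹ (((l : ℕ) : ℝ) - (j : ℝ))⁻¹ b a)
    (∑ r ∈ range (a + b + 1), ((Nat.choose r a : ℝ) + Nat.choose r b) * Zv (a + b + 1 - r)
      * ((l : ℕ) : ℝ)⁻¹ ^ (r + 1)) := by
  unfold TT
  rw [show b + a = a + b by ring]
  simp_rw [← Finset.sum_add_distrib]
  apply hasSum_sum
  intro r hr
  have hr := Finset.mem_range.1 hr
  have hr' : r = a + b ∨ r < a + b := by omega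
  rcases hr' with rfl | hr'
  · have h := (hasSum_tele (l : ℕ)).mul_left ((Nat.choose (a + b) a : ℝ) * ((l : ℕ) : ℝ)⁻¹ ^ (a + b + 1))
    refine hasSum_of_eq h (fun j => ?_) ?_
    · rw [Nat.choose_symm_add]
      simp
      ring
    · simp [Zv]
  · have h1 := hasSum_Zv (a + b + 1 - r) (by omega)
    have h2 := (Equiv.subLeft ((l : ℕ) : ℤ)).hasSum_iff.2 h1
    have := (h1.mul_left ((Nat.choose r a : ℝ) * ((l : ℕ) : ℝ)⁻¹ ^ (r + 1))).add
      (h2.mul_left ((Nat.choose r b : ℝ) * ((l : ℕ) : ℝ)⁻¹ ^ (r + 1)))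
    refine hasSum_of_eq this (fun j => ?_) ?_
    · simp [Function.comp]
      ring
    · ring

theorem hasSum_row (l : ℕ+) (a b : ℕ) (hb : Odd b) :
    HasSum (fun j : ℤ => (((l : ℕ) : ℝ) - (j : ℝ))⁻¹ ^ (a + 1) * (j : ℝ)⁻¹ ^ (b + 1)
      - ((l : ℕ) : ℝ)⁻¹ ^ (a + 1) * (j : ℝ)⁻¹ ^ (b + 1))
    ((∑ r ∈ range (a + b + 1), ((Nat.choose r a : ℝ) + Nat.choose r b) * Zv (a + b + 1 - r)
      * ((l : ℕ) : ℝ)⁻¹ ^ (r + 1)) - (Nat.choose (a + b + 2) (b + 1) : ℝ) * ((l : ℕ) : ℝ)⁻¹ ^ (a + b + 2)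
      - 2 * zetaValue (b + 1) * ((l : ℕ) : ℝ)⁻¹ ^ (a + 1)) := by
  have h1 := hasSum_row_F l a b
  have h2 := hasSum_ite_eq (0 : ℤ) ((Nat.choose (a + b + 1) (b + 1) : ℝ) * ((l : ℕ) : ℝ)⁻¹ ^ (a + b + 2))
  have h3 := hasSum_ite_eq ((l : ℕ) : ℤ) ((Nat.choose (a + b + 1) (a + 1) : ℝ) * ((l : ℕ) : ℝ)⁻¹ ^ (a + b + 2))
  have hb1 : 1 ≤ b := hb.pos
  have h4 := (hasSum_Zv (b + 1) (by omega)).mul_left (((l : ℕ) : ℝ)⁻¹ ^ (a + 1))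
  have := ((h1.sub h2).sub h3).sub h4
  refine hasSum_of_eq this (fun j => ?_) ?_
  · rw [pf_int]
  · rw [Zv, if_pos hb.add_one, Nat.choose_succ_succ (a + b + 1) b,
      show (a + b + 1).choose (a + 1) = (a + b + 1).choose b by
        rw [show a + b + 1 = (a + 1) + b by ring, Nat.choose_symm_add]]
    push_cast
    ring

noncomputable def ww (n : ℕ+) : ℝ := ((n : ℕ) : ℝ)⁻¹ * (√((n : ℕ) : ℝ))⁻¹

theorem ww_summable : Summable ww := by
  have h : Summable (fun n : ℕ => 1 / (n : ℝ) ^ ((3 : ℝ) / 2)) :=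
    Real.summable_one_div_nat_rpow.2 (by norm_num)
  refine (h.comp_injective PNat.coe_injective).congr fun n => ?_
  have hn : (0 : ℝ) < ((n : ℕ) : ℝ) := by exact_mod_cast n.pos
  simp only [Function.comp, ww]
  rw [show (3 : ℝ) / 2 = 1 + 1 / 2 by norm_num, Real.rpow_add hn, Real.rpow_one, Real.sqrt_eq_rpow,
    one_div, mul_inv]

theorem ww2_summable : Summable (fun p : ℕ+ × ℕ+ => ww p.1 * ww p.2) :=
  ww_summable.mul_of_nonneg ww_summable (fun n => by unfold ww; positivity)
    (fun n => by unfold ww; positivity)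

theorem ww_bound (m j : ℕ+) (x : ℝ) (hm : ((m : ℕ) : ℝ) ≤ x) (hj : ((j : ℕ) : ℝ) ≤ x) :
    ((m : ℕ) : ℝ)⁻¹ * ((j : ℕ) : ℝ)⁻¹ * x⁻¹ ≤ ww m * ww j := by
  have hm0 : (0 : ℝ) < ((m : ℕ) : ℝ) := by exact_mod_cast m.pos
  have hj0 : (0 : ℝ) < ((j : ℕ) : ℝ) := by exact_mod_cast j.pos
  have h : √((m : ℕ) : ℝ) * √((j : ℕ) : ℝ) ≤ x := by
    have h1 := Real.sqrt_le_sqrt hm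
    have h2 := Real.sqrt_le_sqrt hj
    calc _ ≤ √x * √x := by gcongr
      _ = x := Real.mul_self_sqrt (by linarith)
  have : x⁻¹ ≤ (√((m : ℕ) : ℝ) * √((j : ℕ) : ℝ))⁻¹ := by
    apply inv_anti₀ _ h
    positivity
  calc _ ≤ ((m : ℕ) : ℝ)⁻¹ * ((j : ℕ) : ℝ)⁻¹ * (√((m : ℕ) : ℝ) * √((j : ℕ) : ℝ))⁻¹ := by gcongr
    _ = _ := by unfold ww; rw [mul_inv]; ring

theorem inv_le_one_pnat (m : ℕ+) : ((m : ℕ) : ℝ)⁻¹ ≤ 1 := by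
  apply inv_le_one_of_one_le₀
  exact_mod_cast m.pos

noncomputable def DD (a b : ℕ) (p : ℕ+ × ℕ+) : ℝ :=
  (((p.1 : ℕ) : ℝ)⁻¹ ^ (a + 1) - (((p.1 : ℕ) : ℝ) + ((p.2 : ℕ) : ℝ))⁻¹ ^ (a + 1)) *
    ((p.2 : ℕ) : ℝ)⁻¹ ^ (b + 1)

theorem DD_summable (a b : ℕ) (hb : 1 ≤ b) : Summable (DD a b) := by
  refine Summable.of_nonneg_of_le ?_ ?_ ww2_summable
  · rintro ⟨m, j⟩
    have hm0 : (0 : ℝ) < ((m : ℕ) : ℝ) := by exact_mod_cast m.pos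
    have hj0 : (0 : ℝ) < ((j : ℕ) : ℝ) := by exact_mod_cast j.pos
    unfold DD
    apply mul_nonneg _ (by positivity)
    rw [sub_nonneg]
    gcongr
    linarith
  · rintro ⟨m, j⟩
    have hm0 : (0 : ℝ) < ((m : ℕ) : ℝ) := by exact_mod_cast m.pos
    have hj0 : (0 : ℝ) < ((j : ℕ) : ℝ) := by exact_mod_cast j.pos
    have hm1 := inv_le_one_pnat m
    have hj1 := inv_le_one_pnat j
    unfold DD
    simp only
    rcases Nat.eq_zero_or_pos a with rfl | ha
    · refine le_trans ?_ (ww_bound m j (((m : ℕ) : ℝ) + ((j : ℕ) : ℝ)) (by linarith) (by linarith))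
      have h1 : ((j : ℕ) : ℝ)⁻¹ ^ b ≤ ((j : ℕ) : ℝ)⁻¹ :=
        pow_le_of_le_one (by positivity) hj1 (by omega)
      calc _ = ((m : ℕ) : ℝ)⁻¹ * ((j : ℕ) : ℝ)⁻¹ ^ b * (((m : ℕ) : ℝ) + ((j : ℕ) : ℝ))⁻¹ := by
            rw [pow_succ _ b]
            have : ((m : ℕ) : ℝ) + ((j : ℕ) : ℝ) ≠ 0 := by positivity
            simp only [zero_add, pow_one]
            field_simp
            ring
        _ ≤ _ := by gcongr
    · have h1 : ∀ (n : ℕ+) (c : ℕ), 1 ≤ c → ((n : ℕ) : ℝ)⁻¹ ^ (c + 1) ≤ ww n := by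
        intro n c hc
        have hn := inv_le_one_pnat n
        have hn0 : (0 : ℝ) < ((n : ℕ) : ℝ) := by exact_mod_cast n.pos
        have hn1 : (1 : ℝ) ≤ ((n : ℕ) : ℝ) := by exact_mod_cast n.pos
        have h1 : ((n : ℕ) : ℝ)⁻¹ ^ c ≤ ((n : ℕ) : ℝ)⁻¹ :=
          pow_le_of_le_one (by positivity) hn (by omega)
        have h2 : ((n : ℕ) : ℝ)⁻¹ ≤ (√((n : ℕ) : ℝ))⁻¹ := by
          apply inv_anti₀ (by positivity)
          rw [Real.sqrt_le_left (by positivity)]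
          nlinarith
        unfold ww
        rw [pow_succ, mul_comm]
        gcongr
        exact h1.trans h2
      have h2 := h1 m a ha
      have h3 := h1 j b hb
      calc _ ≤ ((m : ℕ) : ℝ)⁻¹ ^ (a + 1) * ((j : ℕ) : ℝ)⁻¹ ^ (b + 1) := by
            gcongr
            have : 0 ≤ (((m : ℕ) : ℝ) + ((j : ℕ) : ℝ))⁻¹ ^ (a + 1) := by positivity
            linarith
        _ ≤ _ := by
          gcongr
          unfold ww; positivity

theorem hasSum_dz (a b : ℕ) (hb : 1 ≤ b) :
    HasSum (fun p : {p : ℕ+ × ℕ+ // p.1 < p.2} =>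
      ((p.1.1 : ℕ) : ℝ)⁻¹ ^ (a + 1) * ((p.1.2 : ℕ) : ℝ)⁻¹ ^ (b + 1)) (doubleZeta (a + 1) (b + 1)) := by
  have hs : Summable (fun p : {p : ℕ+ × ℕ+ // p.1 < p.2} =>
      ((p.1.1 : ℕ) : ℝ)⁻¹ ^ (a + 1) * ((p.1.2 : ℕ) : ℝ)⁻¹ ^ (b + 1)) := by
    refine Summable.of_nonneg_of_le (fun p => by positivity) ?_
      (ww2_summable.comp_injective Subtype.val_injective)
    rintro ⟨⟨m, j⟩, h⟩
    have h : m < j := h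
    have hmj : ((m : ℕ) : ℝ) ≤ ((j : ℕ) : ℝ) := by exact_mod_cast h.le
    refine le_trans ?_ (ww_bound m j ((j : ℕ) : ℝ) hmj le_rfl)
    have hm1 := inv_le_one_pnat m
    have hj1 := inv_le_one_pnat j
    simp only
    have h1 : ((j : ℕ) : ℝ)⁻¹ ^ (b + 1) ≤ ((j : ℕ) : ℝ)⁻¹ ^ 2 :=
        pow_le_pow_of_le_one (by positivity) hj1 (by omega)
    have h2 : ((m : ℕ) : ℝ)⁻¹ ^ (a + 1) ≤ ((m : ℕ) : ℝ)⁻¹ :=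
        pow_le_of_le_one (by positivity) hm1 (by omega)
    calc _ ≤ ((m : ℕ) : ℝ)⁻¹ * ((j : ℕ) : ℝ)⁻¹ ^ 2 := by gcongr
      _ = _ := by ring
  refine hasSum_of_eq hs.hasSum (fun _ => rfl) ?_
  unfold doubleZeta
  refine tsum_congr fun p => ?_
  simp [mul_comm]

noncomputable def EE (a b : ℕ) (l : ℕ+) (j : ℤ) : ℝ :=
  (((l : ℕ) : ℝ) - (j : ℝ))⁻¹ ^ (a + 1) * (j : ℝ)⁻¹ ^ (b + 1)
      - ((l : ℕ) : ℝ)⁻¹ ^ (a + 1) * (j : ℝ)⁻¹ ^ (b + 1)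

theorem hasSum_neg (a b : ℕ) (hb : Odd b) :
    HasSum (fun p : ℕ+ × ℕ+ => EE a b p.1 (-((p.2 : ℕ) : ℤ))) (-∑' p, DD a b p) := by
  refine hasSum_of_eq (DD_summable a b hb.pos).hasSum.neg (fun p => ?_) rfl
  unfold EE DD
  push_cast
  rw [inv_neg, hb.add_one.neg_pow]
  ring

theorem cast_sub_pnat {m l : ℕ+} (h : m < l) : (((l - m : ℕ+) : ℕ) : ℝ) = ((l : ℕ) : ℝ) - ((m : ℕ) : ℝ) := by
  have : (l - m) + m = l := PNat.sub_add_of_lt h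
  have h2 : ((l - m : ℕ+) : ℕ) + (m : ℕ) = (l : ℕ) := by
    rw [← PNat.add_coe, this]
  rw [← h2]; push_cast; ring

theorem hasSum_pos (a b : ℕ) (ha : Even a) (hb : Odd b) :
    HasSum (fun p : ℕ+ × ℕ+ => EE a b p.1 ((p.2 : ℕ) : ℤ))
      (∑' p, DD a b p - zetaValue (a + b + 2) - 2 * doubleZeta (a + 1) (b + 1)) := by
  have hb1 : 1 ≤ b := hb.pos
  -- region j < l
  have h1 : HasSum (fun p : ℕ+ × ℕ+ => if p.2 < p.1 then EE a b p.1 ((p.2 : ℕ) : ℤ) else 0)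
      (∑' p, DD a b p) := by
    have hinj : Function.Injective (fun p : ℕ+ × ℕ+ => (p.1 + p.2, p.2)) := by
      rintro ⟨m, j⟩ ⟨m', j'⟩ h
      simp only [Prod.mk.injEq] at h
      obtain ⟨h1, rfl⟩ := h
      simpa using h1
    refine (hinj.hasSum_iff ?_).1 (hasSum_of_eq (DD_summable a b hb1).hasSum (fun p => ?_) rfl)
    · rintro ⟨l, j⟩ h
      refine if_neg fun hlt => h ⟨(l - j, j), ?_⟩
      have hlt : j < l := hlt
      simp [PNat.sub_add_of_lt hlt]
    · have : p.2 < p.1 + p.2 := PNat.lt_add_left _ _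
      simp only [Function.comp, if_pos this]
      unfold EE DD
      push_cast
      rw [add_sub_cancel_right]
      ring
  have h2 : HasSum (fun p : ℕ+ × ℕ+ => if p.2 = p.1 then EE a b p.1 ((p.2 : ℕ) : ℤ) else 0)
      (-zetaValue (a + b + 2)) := by
    have hinj : Function.Injective (fun n : ℕ+ => (n, n)) := by
      intro m n h
      simpa using h
    refine (hinj.hasSum_iff ?_).1 (hasSum_of_eq (hasSum_zeta (a + b + 2) (by omega)).neg (fun p => ?_) rfl)
    · rintro ⟨l, j⟩ h
      refine if_neg fun hlt => h ⟨l, ?_⟩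
      have hlt : j = l := hlt
      simp [hlt]
    · simp [Function.comp, EE]
      rw [← mul_inv, ← pow_add]
      congr 2
      ring
  have hd := hasSum_dz a b hb1
  have h3 : HasSum (fun p : ℕ+ × ℕ+ => if p.1 < p.2 then
      - (((p.1 : ℕ) : ℝ)⁻¹ ^ (a + 1) * ((p.2 : ℕ) : ℝ)⁻¹ ^ (b + 1)) else 0)
      (-doubleZeta (a + 1) (b + 1)) := by
    refine (Subtype.val_injective.hasSum_iff ?_).1 (hasSum_of_eq hd.neg (fun p => ?_) rfl)
    · rintro p h
      refine if_neg fun hlt => h ⟨⟨p, hlt⟩, rfl⟩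
    · simp only [Function.comp, if_pos p.2]
  have h4 : HasSum (fun p : ℕ+ × ℕ+ => if p.1 < p.2 then
      (((p.1 : ℕ) : ℝ) - ((p.2 : ℕ) : ℝ))⁻¹ ^ (a + 1) * ((p.2 : ℕ) : ℝ)⁻¹ ^ (b + 1) else 0)
      (-doubleZeta (a + 1) (b + 1)) := by
    have hinj : Function.Injective
        (fun p : {p : ℕ+ × ℕ+ // p.1 < p.2} => (p.1.2 - p.1.1, p.1.2)) := by
      rintro ⟨⟨m, j⟩, h⟩ ⟨⟨m', j'⟩, h'⟩ heq
      simp only [Prod.mk.injEq] at heq h h'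
      obtain ⟨h1, rfl⟩ := heq
      have e1 := PNat.sub_add_of_lt h
      have e2 := PNat.sub_add_of_lt h'
      rw [h1, ← e2] at e1
      simp only [Subtype.mk.injEq, Prod.mk.injEq, and_true]
      have e3 : j - m' + m = j - m' + m' := by rw [← h1, PNat.sub_add_of_lt h, h1, e2]
      exact add_left_cancel e3
    refine (hinj.hasSum_iff ?_).1 (hasSum_of_eq hd.neg (fun p => ?_) rfl)
    · rintro ⟨l, j⟩ h
      refine if_neg fun hlt => h ?_
      have hlt : l < j := hlt
      have hs : (j - l) + l = j := PNat.sub_add_of_lt hlt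
      have hlt2 : j - l < j := by
        conv_rhs => rw [← hs]
        exact PNat.lt_add_right _ _
      refine ⟨⟨(j - l, j), hlt2⟩, ?_⟩
      simp only [Prod.mk.injEq, and_true]
      have hs2 : (j - (j - l)) + (j - l) = j := PNat.sub_add_of_lt hlt2
      have e3 : (j - (j - l)) + (j - l) = l + (j - l) := by rw [hs2, add_comm, hs]
      exact add_right_cancel e3
    · obtain ⟨⟨m, j⟩, h⟩ := p
      have h : m < j := h
      have hlt2 : j - m < j := by
        conv_rhs => rw [← PNat.sub_add_of_lt h]
        exact PNat.lt_add_right _ _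
      simp only [Function.comp, if_pos hlt2, cast_sub_pnat h]
      rw [sub_sub_cancel_left, inv_neg, ha.add_one.neg_pow]
      ring
  refine hasSum_of_eq (((h1.add h2).add h3).add h4) (fun p => ?_) (by ring)
  obtain ⟨l, j⟩ := p
  simp only
  rcases lt_trichotomy l j with h | h | h
  · rw [if_neg h.not_gt, if_neg h.ne', if_pos h, if_pos h]
    simp only [EE, Int.cast_natCast]
    ring
  · subst h
    simp
  · rw [if_pos h, if_neg h.ne, if_neg h.not_gt, if_neg h.not_gt]
    ring

theorem hasSum_rows (a b : ℕ) (ha : Even a) (hb : Odd b) (g : ℕ+ → ℝ)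
    (hg : ∀ l, HasSum (EE a b l) (g l)) :
    HasSum g (- zetaValue (a + b + 2) - 2 * doubleZeta (a + 1) (b + 1)) := by
  have h1 := hasSum_pos a b ha hb
  have h2 := hasSum_neg a b hb
  refine (hasSum_of_eq (h1.add h2) (fun _ => rfl) (by ring)).prod_fiberwise fun l => ?_
  have r1 := (h1.summable.prod_factor l).hasSum
  have r2 := (h2.summable.prod_factor l).hasSum
  have := hasSum_int_of_pnat (f := EE a b l) (by simp [EE]) r1 r2
  rw [(hg l).unique this]
  exact r1.add r2

theorem key_identity (a b : ℕ) (ha : Even a) (hb : Odd b) :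
    - zetaValue (a + b + 2) - 2 * doubleZeta (a + 1) (b + 1) =
    (∑ r ∈ range (a + b), ((Nat.choose (r + 1) a : ℝ) + Nat.choose (r + 1) b) * Zv (a + b - r)
      * zetaValue (r + 2)) - (Nat.choose (a + b + 2) (b + 1) : ℝ) * zetaValue (a + b + 2)
      - (if 1 ≤ a then 2 * (zetaValue (a + 1) * zetaValue (b + 1)) else 0) := by
  have hb1 : 1 ≤ b := hb.pos
  refine (hasSum_rows a b ha hb _ (fun l => hasSum_row l a b hb)).unique ?_
  have h1 : HasSum (fun l : ℕ+ => ∑ r ∈ range (a + b), ((Nat.choose (r + 1) a : ℝ) + Nat.choose (r + 1) b)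
      * Zv (a + b - r) * ((l : ℕ) : ℝ)⁻¹ ^ (r + 2)) _ :=
    hasSum_sum fun r _ => (hasSum_zeta (r + 2) (by omega)).mul_left _
  have h2 := (hasSum_zeta (a + b + 2) (by omega)).mul_left (Nat.choose (a + b + 2) (b + 1) : ℝ)
  have hc : ((0 : ℕ).choose b : ℝ) = 0 := by
    rw [Nat.choose_eq_zero_of_lt (by omega)]; simp
  by_cases h : 1 ≤ a
  · have hc' : ((0 : ℕ).choose a : ℝ) = 0 := by
      rw [Nat.choose_eq_zero_of_lt (by omega)]; simp
    have h3 := (hasSum_zeta (a + 1) (by omega)).mul_left (2 * zetaValue (b + 1))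
    refine hasSum_of_eq ((h1.sub h2).sub h3) (fun l => ?_) (by rw [if_pos h]; ring)
    rw [Finset.sum_range_succ', hc, hc']
    simp
  · obtain rfl : a = 0 := by omega
    refine hasSum_of_eq (h1.sub h2) (fun l => ?_) (by rw [if_neg h]; ring)
    rw [Finset.sum_range_succ', hc]
    simp [Zv, hb.add_one]
    ring

/-- for `a ≥ 1` odd and `b ≥ 2` even, `N = a + b`,
`ζ(a,b) = -∑_{r odd, 3 ≤ r ≤ N-2} (C(r-1,b-1) + C(r-1,a-1)) ζ(r) ζ(N-r)
  + ½(C(N,b) - 1) ζ(N) + [a ≥ 3] ζ(a) ζ(b)`. -/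
theorem doubleZeta_odd_even (a b : ℕ) (ha : 1 ≤ a) (hao : Odd a)
    (hb : 2 ≤ b) (hbe : Even b) :
    doubleZeta a b =
      -(∑ r ∈ (Finset.Icc 3 (a + b - 2)).filter (fun r => Odd r),
        ((Nat.choose (r - 1) (b - 1) + Nat.choose (r - 1) (a - 1) : ℕ) : ℝ) *
          zetaValue r * zetaValue (a + b - r)) +
      (1 / 2) * (((Nat.choose (a + b) b : ℕ) : ℝ) - 1) * zetaValue (a + b) +
      (if 3 ≤ a then (1 : ℝ) else 0) * (zetaValue a * zetaValue b) := by
  obtain ⟨A, rfl⟩ : ∃ A, a = A + 1 := ⟨a - 1, by omega⟩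
  obtain ⟨B, rfl⟩ : ∃ B, b = B + 1 := ⟨b - 1, by omega⟩
  have hA : Even A := by rcases Nat.even_or_odd A with h | h; exact h; exact absurd hao (Nat.not_odd_iff_even.2 h.add_one)
  have hB : Odd B := by rcases Nat.even_or_odd B with h | h; exact absurd hbe (Nat.not_even_iff_odd.2 h.add_one); exact h
  have key := key_identity A B hA hB
  have hS : ∑ r ∈ range (A + B), ((Nat.choose (r + 1) A : ℝ) + Nat.choose (r + 1) B) * Zv (A + B - r)
      * zetaValue (r + 2) = 2 * ∑ r ∈ (Finset.Icc 3 (A + 1 + (B + 1) - 2)).filter (fun r => Odd r),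
        ((Nat.choose (r - 1) (B + 1 - 1) + Nat.choose (r - 1) (A + 1 - 1) : ℕ) : ℝ) *
          zetaValue r * zetaValue (A + 1 + (B + 1) - r) := by
    rw [Finset.mul_sum, Finset.sum_filter]
    have hAB : Odd (A + B) := hA.add_odd hB
    have e1 : ∀ r ∈ range (A + B), ((Nat.choose (r + 1) A : ℝ) + Nat.choose (r + 1) B) * Zv (A + B - r)
      * zetaValue (r + 2) = (fun r => if Odd r then 2 * (((Nat.choose (r - 1) (B + 1 - 1) + Nat.choose (r - 1) (A + 1 - 1) : ℕ) : ℝ) *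
          zetaValue r * zetaValue (A + 1 + (B + 1) - r)) else 0) (2 + r) := by
      intro r hr
      have hr := Finset.mem_range.1 hr
      simp only [Zv]
      have : Even (A + B - r) ↔ Odd (2 + r) := by
        rw [Nat.even_iff, Nat.odd_iff]; rw [Nat.odd_iff] at hAB; omega
      by_cases ho : Odd (2 + r)
      · rw [if_pos (this.2 ho), if_pos ho, show A + 1 + (B + 1) - (2 + r) = A + B - r by omega,
          show 2 + r - 1 = r + 1 by omega, add_comm 2 r]
        push_cast
        ring
      · rw [if_neg (fun h => ho (this.1 h)), if_neg ho]; simp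
    rw [Finset.sum_congr rfl e1]
    have := Finset.sum_Ico_eq_sum_range (fun r => if Odd r then 2 * (((Nat.choose (r - 1) (B + 1 - 1) + Nat.choose (r - 1) (A + 1 - 1) : ℕ) : ℝ) *
          zetaValue r * zetaValue (A + 1 + (B + 1) - r)) else 0) 2 (A + B + 2)
    rw [show A + B + 2 - 2 = A + B by omega] at this
    rw [← this]
    symm
    apply Finset.sum_subset_zero_on_sdiff
    · intro r hr
      simp only [Finset.mem_Icc, Finset.mem_Ico] at hr ⊢
      omega
    · intro r hr
      simp only [Finset.mem_sdiff, Finset.mem_Icc, Finset.mem_Ico] at hr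
      apply if_neg
      rw [Nat.odd_iff] at hAB ⊢
      omega
    · intro r _; rfl
  rw [hS] at key
  rw [show A + B + 2 = A + 1 + (B + 1) by ring] at key
  have hif : (if 1 ≤ A then 2 * (zetaValue (A + 1) * zetaValue (B + 1)) else 0) =
      2 * ((if 3 ≤ A + 1 then (1 : ℝ) else 0) * (zetaValue (A + 1) * zetaValue (B + 1))) := by
    have : 1 ≤ A ↔ 3 ≤ A + 1 := by rw [Nat.even_iff] at hA; omega
    by_cases h : 1 ≤ A
    · rw [if_pos h, if_pos (this.1 h)]; ring
    · rw [if_neg h, if_neg (fun h' => h (this.2 h'))]; ring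
  rw [hif] at key
  linarith
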